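/- arXiv:math/0107080 — 2 statements merged into one kernel-verified Lean document; each statement's English description precedes it below -/
import Mathlib

section
/- Let k ≥ 1, let s ∈ ℝ, let c_0, …, c_{k−1} be nonzero real numbers, and let λ_0, …, λ_{k−1} be real numbers with |λ_0| > |λ_1| > … > |λ_{k−1}| > 0 and λ_j ≠ 1 for all j. Define s_n = s + Σ_{j=0}^{k−1} c_j·λ_j^n. Fix n ≥ 0 and assume that in Wynn's epsilon algorithm applied to (s_n) all differences ε_m^{(i+1)} − ε_m^{(i)} appearing in the computation of ε_{2k}^{(n)} (for 0 ≤ m < 2k) are nonzero. Then the epsilon algorithm is exact for this model sequence: ε_{2k}^{(n)} = s. -/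
/-- Wynn's epsilon algorithm, with the first index shifted by one:
`wynnEps s 0 n = ε₋₁⁽ⁿ⁾ = 0`, `wynnEps s 1 n = ε₀⁽ⁿ⁾ = sₙ`, and
`wynnEps s (k+2) n = ε_{k+1}⁽ⁿ⁾ = ε_{k-1}⁽ⁿ⁺¹⁾ + 1/(ε_k⁽ⁿ⁺¹⁾ - ε_k⁽ⁿ⁾)`. -/
noncomputable def wynnEps (s : ℕ → ℝ) : ℕ → ℕ → ℝ
  | 0, _ => 0
  | 1, n => s n
  | (k + 2), n =>
      wynnEps s k (n + 1) + 1 / (wynnEps s (k + 1) (n + 1) - wynnEps s (k + 1) n)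

open Polynomial

/-- The shift operator on real sequences. -/
noncomputable def wShift : Module.End ℝ (ℕ → ℝ) where
  toFun t := fun n => t (n + 1)
  map_add' _ _ := rfl
  map_smul' _ _ := rfl

/-- A polynomial in the shift operator, applied to a sequence. -/
noncomputable def wApp (P : ℝ[X]) (t : ℕ → ℝ) : ℕ → ℝ := aeval wShift P t

lemma wShift_pow (l : ℕ) (t : ℕ → ℝ) (n : ℕ) : (wShift ^ l) t n = t (n + l) := by
  induction l generalizing n with
  | zero => simp
  | succ l ih =>
    rw [pow_succ', Module.End.mul_apply]
    change (wShift ^ l) t (n + 1) = _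
    rw [ih]; congr 1; ring

lemma wApp_eq_sum {P : ℝ[X]} {j : ℕ} (h : P.natDegree ≤ j) (t : ℕ → ℝ) (n : ℕ) :
    wApp P t n = ∑ l ∈ Finset.range (j + 1), P.coeff l * t (n + l) := by
  unfold wApp
  rw [aeval_eq_sum_range' (Nat.lt_succ_of_le h)]
  simp [LinearMap.sum_apply, Finset.sum_apply, wShift_pow]

lemma wApp_const {P : ℝ[X]} {j : ℕ} (h : P.natDegree ≤ j) {t : ℕ → ℝ} {n : ℕ} {v : ℝ}
    (ht : ∀ l ≤ j, t (n + l) = v) : wApp P t n = P.eval 1 * v := by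
  rw [wApp_eq_sum h, eval_eq_sum_range' (Nat.lt_succ_of_le h), Finset.sum_mul]
  refine Finset.sum_congr rfl fun l hl => ?_
  rw [ht l (by simpa [Nat.lt_succ_iff] using hl)]
  simp

lemma wApp_mul (P Q : ℝ[X]) (t : ℕ → ℝ) : wApp (P * Q) t = wApp P (wApp Q t) := by
  simp [wApp]

lemma wApp_add (P Q : ℝ[X]) (t : ℕ → ℝ) (n : ℕ) :
    wApp (P + Q) t n = wApp P t n + wApp Q t n := by
  simp [wApp]

lemma wApp_sub (P Q : ℝ[X]) (t : ℕ → ℝ) (n : ℕ) :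
    wApp (P - Q) t n = wApp P t n - wApp Q t n := by
  simp [wApp]

lemma wApp_C_mul (a : ℝ) (P : ℝ[X]) (t : ℕ → ℝ) (n : ℕ) :
    wApp (C a * P) t n = a * wApp P t n := by
  simp [wApp]

lemma wApp_one (t : ℕ → ℝ) (n : ℕ) : wApp 1 t n = t n := by
  simp [wApp]

lemma wApp_X_mul (P : ℝ[X]) (t : ℕ → ℝ) (n : ℕ) :
    wApp (X * P) t n = wApp P t (n + 1) := by
  rw [wApp_mul]; simp [wApp, wShift]

lemma wApp_mul_sub (P : ℝ[X]) (t : ℕ → ℝ) (n : ℕ) :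
    wApp (P * (X - 1)) t n = wApp P t (n + 1) - wApp P t n := by
  rw [show P * (X - 1) = X * P - P by ring, wApp_sub, wApp_X_mul]

/-- Shanks-type characterisation of even columns. -/
def CandA (s : ℕ → ℝ) (j n : ℕ) (v : ℝ) : Prop :=
  ∃ A : ℝ[X], A.natDegree ≤ j ∧ A.eval 1 = 1 ∧ ∀ i ≤ j, wApp A s (n + i) = v

/-- Shanks-type characterisation of odd columns. -/
def CandB (s : ℕ → ℝ) (j n : ℕ) (v : ℝ) : Prop :=
  ∃ B : ℝ[X], B.natDegree ≤ j ∧ B.eval 1 = v ∧ ∀ i ≤ j, wApp (B * (X - 1)) s (n + i) = 1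

lemma CandA.unique {s : ℕ → ℝ} {j n : ℕ} {v w : ℝ} (h : CandA s j n v) (h' : CandA s j n w) :
    v = w := by
  obtain ⟨A, hA, hA1, hAs⟩ := h
  obtain ⟨A', hA', hA1', hAs'⟩ := h'
  have e1 : wApp (A' * A) s n = v := by
    rw [wApp_mul, wApp_const hA' hAs, hA1', one_mul]
  have e2 : wApp (A * A') s n = w := by
    rw [wApp_mul, wApp_const hA hAs', hA1, one_mul]
  rw [← e1, ← e2, mul_comm]

lemma CandB.unique {s : ℕ → ℝ} {j n : ℕ} {v w : ℝ} (h : CandB s j n v) (h' : CandB s j n w) :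
    v = w := by
  obtain ⟨A, hA, hA1, hAs⟩ := h
  obtain ⟨A', hA', hA1', hAs'⟩ := h'
  have e1 : wApp (A' * (A * (X - 1))) s n = w := by
    rw [wApp_mul, wApp_const hA' hAs, hA1', mul_one]
  have e2 : wApp (A * (A' * (X - 1))) s n = v := by
    rw [wApp_mul, wApp_const hA hAs', hA1, mul_one]
  rw [← e1, ← e2]; congr 1; ring

lemma stepB {s : ℕ → ℝ} {j n : ℕ} {u v w : ℝ} (hv : CandA s (j + 1) n v)
    (hw : CandA s (j + 1) (n + 1) w) (hu : CandB s j (n + 1) u) (hne : w - v ≠ 0) :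
    CandB s (j + 1) n (u + 1 / (w - v)) := by
  obtain ⟨A, hA, hA1, hAs⟩ := hv
  obtain ⟨A', hA', hA1', hAs'⟩ := hw
  obtain ⟨R, hR⟩ : (X - C 1) ∣ A' - A := by
    rw [dvd_iff_isRoot]; simp [hA1, hA1']
  have hRd : R.natDegree ≤ j := by
    by_cases h0 : R = 0
    · simp [h0]
    have h1 : (A' - A).natDegree ≤ j + 1 := (natDegree_sub_le _ _).trans (max_le hA' hA)
    rw [hR, (monic_X_sub_C (1 : ℝ)).natDegree_mul' h0, natDegree_X_sub_C] at h1
    omega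
  have hRm : R * (X - 1) = A' - A := by rw [hR, C_1]; ring
  have hshift : ∀ i ≤ j + 1, wApp A' s (n + i + 1) = w := by
    intro i hi; rw [← hAs' i hi]; congr 1; ring
  have hRu : u = (w - v)⁻¹ * R.eval 1 := by
    refine hu.unique ⟨C (w - v)⁻¹ * R, (natDegree_C_mul_le _ _).trans hRd, by simp, ?_⟩
    intro i hi
    rw [mul_assoc, wApp_C_mul, hRm, wApp_sub, hAs' i (by omega),
      show n + 1 + i = n + (i + 1) by ring, hAs (i + 1) (by omega), inv_mul_cancel₀ hne]
  refine ⟨C (w - v)⁻¹ * (A' + R), ?_, ?_, ?_⟩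
  · exact (natDegree_C_mul_le _ _).trans ((natDegree_add_le _ _).trans (max_le hA' (by omega)))
  · simp [hA1', hRu]; ring
  · intro i hi
    rw [mul_assoc, wApp_C_mul, show (A' + R) * (X - 1) = X * A' - A by
      rw [add_mul, hRm]; ring, wApp_sub, wApp_X_mul, hshift i hi, hAs i hi, inv_mul_cancel₀ hne]

lemma stepA {s : ℕ → ℝ} {j n : ℕ} {u v w : ℝ} (hv : CandB s j n v)
    (hw : CandB s j (n + 1) w) (hu : CandA s j (n + 1) u) (hne : w - v ≠ 0) :
    CandA s (j + 1) n (u + 1 / (w - v)) := by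
  obtain ⟨B, hB, hB1, hBs⟩ := hv
  obtain ⟨B', hB', hB1', hBs'⟩ := hw
  -- the difference is a candidate in the previous even column
  have hD : ∀ i ≤ j, wApp (B' - B) s (n + 1 + i) = wApp (B' - B) s (n + 1) := by
    intro i
    induction i with
    | zero => simp
    | succ i ih =>
      intro hi
      rw [← ih (by omega)]
      have h := wApp_mul_sub (B' - B) s (n + 1 + i)
      rw [sub_mul, wApp_sub, hBs' i (by omega), show n + 1 + i = n + (i + 1) by ring,
        hBs (i + 1) hi] at h
      rw [show n + 1 + (i + 1) = n + (i + 1) + 1 by ring, show n + 1 + i = n + (i + 1) by ring]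
      linarith
  have hDu : u = (w - v)⁻¹ * wApp (B' - B) s (n + 1) := by
    refine hu.unique ⟨C (w - v)⁻¹ * (B' - B), ?_, ?_, ?_⟩
    · exact (natDegree_C_mul_le _ _).trans ((natDegree_sub_le _ _).trans (max_le hB' hB))
    · simp [hB1, hB1', hne]
    · intro i hi
      rw [wApp_C_mul, hD i hi]
  have hE : ∀ i ≤ j + 1, wApp (X * B' - B) s (n + i) = wApp (X * B' - B) s n := by
    intro i
    induction i with
    | zero => simp
    | succ i ih =>
      intro hi
      rw [← ih (by omega)]
      have h := wApp_mul_sub (X * B' - B) s (n + i)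
      rw [sub_mul, wApp_sub, mul_assoc, wApp_X_mul, hBs i (by omega),
        show n + i + 1 = n + 1 + i by ring, hBs' i (by omega)] at h
      rw [show n + (i + 1) = n + 1 + i by ring]
      linarith
  have hval : wApp (X * B' - B) s n = 1 + wApp (B' - B) s (n + 1) := by
    rw [← hE 1 (by omega), show X * B' - B = B' * (X - 1) + (B' - B) by ring, wApp_add]
    have := hBs' 0 (by omega)
    rw [add_zero] at this
    rw [this]
  refine ⟨C (w - v)⁻¹ * (X * B' - B), ?_, ?_, ?_⟩
  · refine (natDegree_C_mul_le _ _).trans ((natDegree_sub_le _ _).trans (max_le ?_ (by omega)))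
    refine natDegree_mul_le.trans ?_
    rw [natDegree_X]; omega
  · simp [hB1, hB1', hne]
  · intro i hi
    rw [wApp_C_mul, hE i hi, hval, hDu]; ring

lemma wynn_cand (s : ℕ → ℝ) (n k : ℕ)
    (hnz : ∀ m i : ℕ, m < 2 * k → n ≤ i → i + m + 1 ≤ n + 2 * k →
      wynnEps s (m + 1) (i + 1) - wynnEps s (m + 1) i ≠ 0) (j : ℕ) :
    (∀ i, n ≤ i → i + 2 * j ≤ n + 2 * k → CandA s j i (wynnEps s (2 * j + 1) i)) ∧
    (∀ i, n ≤ i → i + 2 * j + 1 ≤ n + 2 * k → CandB s j i (wynnEps s (2 * j + 2) i)) := by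
  induction j with
  | zero =>
    constructor
    · intro i _ _
      refine ⟨1, by simp, by simp, ?_⟩
      intro l hl
      obtain rfl : l = 0 := by omega
      rw [wApp_one]; simp [wynnEps]
    · intro i hi hi'
      have h := hnz 0 i (by omega) hi (by omega)
      simp only [wynnEps, zero_add] at h
      refine ⟨C (s (i + 1) - s i)⁻¹ * 1, by simp, by simp [wynnEps], ?_⟩
      intro l hl
      obtain rfl : l = 0 := by omega
      rw [mul_assoc, wApp_C_mul, wApp_mul_sub, wApp_one, wApp_one]
      exact inv_mul_cancel₀ h
  | succ j ih =>
    have hA : ∀ i, n ≤ i → i + 2 * (j + 1) ≤ n + 2 * k →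
        CandA s (j + 1) i (wynnEps s (2 * (j + 1) + 1) i) := by
      intro i hi hi'
      exact stepA (ih.2 i hi (by omega)) (ih.2 (i + 1) (by omega) (by omega))
        (ih.1 (i + 1) (by omega) (by omega)) (hnz (2 * j + 1) i (by omega) hi (by omega))
    refine ⟨hA, ?_⟩
    intro i hi hi'
    exact stepB (hA i hi (by omega)) (hA (i + 1) (by omega) (by omega))
      (ih.2 (i + 1) (by omega) (by omega)) (hnz (2 * (j + 1)) i (by omega) hi (by omega))

lemma wApp_geom (P : ℝ[X]) (x : ℝ) (n : ℕ) :
    wApp P (fun m => x ^ m) n = P.eval x * x ^ n := by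
  rw [wApp_eq_sum le_rfl, eval_eq_sum_range, Finset.sum_mul]
  refine Finset.sum_congr rfl fun l _ => ?_
  ring

/-- Wynn's epsilon algorithm is exact for a model sequence consisting of
the (generalized) limit `s` plus `k ≥ 1` exponential terms `cⱼ·λⱼⁿ` with nonzero
coefficients and `|λ₀| > |λ₁| > … > |λ_{k-1}| > 0`, `λⱼ ≠ 1`: provided all the
differences `ε_m⁽ⁱ⁺¹⁾ - ε_m⁽ⁱ⁾` (for `0 ≤ m < 2k`) appearing in the computation
of `ε_{2k}⁽ⁿ⁾` are nonzero, one has `ε_{2k}⁽ⁿ⁾ = s`.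
(In `wynnEps`, the mathematical entry `ε_m⁽ⁱ⁾` is `wynnEps s (m+1) i`.) -/
theorem wynnEps_exact_for_sum_of_exponentials
    (k : ℕ) (hk : 1 ≤ k) (s : ℝ) (c : Fin k → ℝ) (lam : Fin k → ℝ)
    (hc : ∀ j, c j ≠ 0)
    (hlam_pos : ∀ j, lam j ≠ 0)
    (hlam_one : ∀ j, lam j ≠ 1)
    (hlam_mono : ∀ i j : Fin k, i < j → |lam j| < |lam i|)
    (sn : ℕ → ℝ) (hsn : ∀ n : ℕ, sn n = s + ∑ j : Fin k, c j * lam j ^ n)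
    (n : ℕ)
    (hnz : ∀ m i : ℕ, m < 2 * k → n ≤ i → i + m + 1 ≤ n + 2 * k →
      wynnEps sn (m + 1) (i + 1) - wynnEps sn (m + 1) i ≠ 0) :
    wynnEps sn (2 * k + 1) n = s := by
  have hcand := (wynn_cand sn n k hnz k).1 n le_rfl le_rfl
  refine hcand.unique ?_
  set P : ℝ[X] := ∏ j : Fin k, (X - C (lam j)) with hP
  have hP1 : P.eval 1 ≠ 0 := by
    rw [hP, eval_prod]
    refine Finset.prod_ne_zero_iff.2 fun j _ => ?_
    simpa [sub_eq_zero] using (hlam_one j).symm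
  have hPl : ∀ j, P.eval (lam j) = 0 := by
    intro j
    rw [hP, eval_prod]
    exact Finset.prod_eq_zero (Finset.mem_univ j) (by simp)
  have hseq : sn = s • (fun m => (1 : ℝ) ^ m) + ∑ j : Fin k, c j • (fun m => lam j ^ m) := by
    funext m
    simp [hsn, Finset.sum_apply]
  have hPs : ∀ m, wApp P sn m = P.eval 1 * s := by
    intro m
    have h1 := wApp_geom P 1 m
    have h2 : ∀ j, wApp P (fun m => lam j ^ m) m = 0 := by
      intro j; rw [wApp_geom, hPl, zero_mul]
    unfold wApp at h1 h2 ⊢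
    rw [hseq, map_add, map_smul, map_sum]
    simp only [map_smul, Pi.add_apply, Pi.smul_apply, Finset.sum_apply, h1, h2]
    simp [mul_comm]
  refine ⟨C (P.eval 1)⁻¹ * P, ?_, ?_, ?_⟩
  · refine (natDegree_C_mul_le _ _).trans ?_
    rw [hP, natDegree_prod_of_monic _ _ fun j _ => monic_X_sub_C _]
    simp
  · simp [hP1]
  · intro i _
    rw [wApp_C_mul, hPs, inv_mul_cancel_left₀ hP1]
end

section
/- Euler–Maclaurin expansion of the truncation error of the Dirichlet series for the Riemann zeta function: let z ∈ ℂ with Re(z) > 1, let n ≥ 0 and k ≥ 1. Then Σ_{ν=n+1}^{∞} (ν+1)^{−z} = (n+2)^{1−z}/(z−1) + (1/2)(n+2)^{−z} + Σ_{j=1}^{k} ((z)_{2j−1}·B_{2j}/(2j)!)·(n+2)^{−z−2j+1} + R_k(n,z), where R_k(n,z) = −((z)_{2k}/(2k)!)·∫_{n+1}^{∞} B_{2k}(x − ⌊x⌋)/(1+x)^{z+2k} dx, the series on the left and the integral on the right both being (absolutely) convergent. -/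
open scoped Nat

/-- The periodized Bernoulli kernel times the power `(1+x)^{-(z+m)}`. -/
noncomputable def emG (z : ℂ) (m : ℕ) (x : ℝ) : ℂ :=
  (bernoulliFun m (x - (⌊x⌋ : ℝ)) : ℂ) / ((1 : ℂ) + (x : ℂ)) ^ (z + (m : ℂ))

lemma em_hasDerivAt_pow (w : ℂ) (hw : w ≠ 0) (x : ℝ) (hx : 0 < 1 + x) :
    HasDerivAt (fun y : ℝ => ((1 : ℂ) + (y : ℂ)) ^ (-w))
      (-w * ((1 : ℂ) + (x : ℂ)) ^ (-(w + 1))) x := by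
  have h := (hasDerivAt_ofReal_cpow_const (x := 1 + x) hx.ne' (r := -w) (neg_ne_zero.mpr hw))
  have h2 := HasDerivAt.comp_const_add (1 : ℝ) x h
  have e : -w - 1 = -(w + 1) := by ring
  rw [e] at h2
  simpa using h2

lemma em_integrable (z : ℂ) (hz : 1 < z.re) (n m : ℕ) :
    MeasureTheory.IntegrableOn (emG z m) (Set.Ioi ((n : ℝ) + 1)) := by
  obtain ⟨C, hC⟩ := (isCompact_Icc (a := (0 : ℝ)) (b := 1)).exists_bound_of_continuousOn
    (continuous_bernoulliFun m).continuousOn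
  have hmeas : Measurable (fun x : ℝ => ((bernoulliFun m (x - (⌊x⌋ : ℝ)) : ℝ) : ℂ)) := by
    apply Complex.measurable_ofReal.comp
    apply (continuous_bernoulliFun m).measurable.comp
    exact measurable_fract
  have hint : MeasureTheory.IntegrableOn
      (fun x : ℝ => (((1 : ℂ) + (x : ℂ)) ^ (z + (m : ℂ)))⁻¹) (Set.Ioi ((n : ℝ) + 1)) := by
    have h0 : MeasureTheory.IntegrableOn (fun x : ℝ => (x + 1) ^ (-(z.re + m)))
        (Set.Ioi ((n : ℝ) + 1)) := by
      apply integrableOn_add_rpow_Ioi_of_lt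
      · have : (0 : ℝ) ≤ m := by positivity
        linarith
      · have : (0 : ℝ) ≤ n := by positivity
        linarith
    refine h0.mono' ?_ ?_
    · exact (Measurable.inv (by fun_prop)).aestronglyMeasurable
    · filter_upwards [MeasureTheory.ae_restrict_mem measurableSet_Ioi] with x hx
      have hx' : 0 < 1 + x := by
        have : (0 : ℝ) ≤ n := by positivity
        have := Set.mem_Ioi.mp hx
        linarith
      rw [norm_inv]
      have e : (1 : ℂ) + (x : ℂ) = ((1 + x : ℝ) : ℂ) := by push_cast; rfl
      rw [e, Complex.norm_cpow_eq_rpow_re_of_pos hx', ← Real.rpow_neg hx'.le, add_comm x 1]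
      simp
  have := MeasureTheory.Integrable.bdd_mul (c := C) hint hmeas.aestronglyMeasurable
    (Filter.Eventually.of_forall fun x => by
      rw [Complex.norm_real]
      exact hC _ ⟨Int.fract_nonneg x, (Int.fract_lt_one x).le⟩)
  exact this

lemma em_step (z : ℂ) (hz : 1 < z.re) (p m : ℕ) :
    ((m : ℂ) + 1) * ∫ x in (p : ℝ)..((p : ℝ) + 1), emG z m x =
      (bernoulliFun (m + 1) 1 : ℂ) * ((p : ℂ) + 2) ^ (-(z + m))
      - (bernoulliFun (m + 1) 0 : ℂ) * ((p : ℂ) + 1) ^ (-(z + m))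
      + (z + m) * ∫ x in (p : ℝ)..((p : ℝ) + 1), emG z (m + 1) x := by
  have hp : (0 : ℝ) ≤ p := by positivity
  have hzm : ∀ j : ℕ, z + j ≠ 0 := by
    intro j h
    have := congrArg Complex.re h
    have : (0 : ℝ) ≤ j := by positivity
    simp at *
    linarith
  let H : ℕ → ℝ → ℂ := fun j x =>
    (bernoulliFun j (x - p) : ℂ) * ((1 : ℂ) + (x : ℂ)) ^ (-(z + (j : ℂ)))
  have hG : ∀ j : ℕ, ∫ x in (p : ℝ)..((p : ℝ) + 1), emG z j x =
      ∫ x in (p : ℝ)..((p : ℝ) + 1), H j x := by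
    intro j
    apply intervalIntegral.integral_congr_Ioo_of_le (by linarith)
    intro x hx
    have hfl : ⌊x⌋ = (p : ℤ) := by
      rw [Int.floor_eq_iff]
      push_cast
      exact ⟨hx.1.le, hx.2⟩
    simp only [emG, H, hfl, Complex.cpow_neg, div_eq_mul_inv]
    push_cast
    rfl
  have hpos : ∀ x ∈ Set.uIcc (p : ℝ) ((p : ℝ) + 1), 0 < 1 + x := by
    intro x hx
    rw [Set.uIcc_of_le (by linarith)] at hx
    linarith [hx.1]
  have hI : ∀ j : ℕ, IntervalIntegrable (H j) MeasureTheory.volume (p : ℝ) ((p : ℝ) + 1) := by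
    intro j
    apply ContinuousOn.intervalIntegrable
    apply ContinuousOn.mul
    · exact (Complex.continuous_ofReal.comp
        ((continuous_bernoulliFun j).comp (by fun_prop))).continuousOn
    · intro x hx
      exact (em_hasDerivAt_pow _ (hzm j) x (hpos x hx)).continuousAt.continuousWithinAt
  have hd : ∀ x ∈ Set.uIcc (p : ℝ) ((p : ℝ) + 1),
      HasDerivAt (fun x : ℝ => (bernoulliFun (m + 1) (x - p) : ℂ) *
        ((1 : ℂ) + (x : ℂ)) ^ (-(z + (m : ℂ))))
        (((m : ℂ) + 1) * H m x - (z + m) * H (m + 1) x) x := by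
    intro x hx
    have h1 : HasDerivAt (fun x : ℝ => (bernoulliFun (m + 1) (x - p) : ℂ))
        ((((m + 1 : ℕ) : ℝ) * bernoulliFun m (x - p) : ℝ) : ℂ) x :=
      ((hasDerivAt_bernoulliFun (m + 1) (x - p)).comp_sub_const x (p : ℝ)).ofReal_comp
    have h2 := h1.mul (em_hasDerivAt_pow _ (hzm m) x (hpos x hx))
    refine h2.congr_deriv ?_
    simp only [H]
    push_cast
    rw [add_assoc z]
    ring
  have hF := intervalIntegral.integral_eq_sub_of_hasDerivAt hd
    (((hI m).const_mul _).sub ((hI (m + 1)).const_mul _))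
  rw [intervalIntegral.integral_sub ((hI m).const_mul _) ((hI (m + 1)).const_mul _),
    intervalIntegral.integral_const_mul, intervalIntegral.integral_const_mul] at hF
  rw [hG, hG]
  have e1 : (1 : ℂ) + (((p : ℝ) + 1 : ℝ) : ℂ) = (p : ℂ) + 2 := by push_cast; ring
  have e2 : (1 : ℂ) + (((p : ℝ) : ℝ) : ℂ) = (p : ℂ) + 1 := by push_cast; ring
  rw [e1, e2] at hF
  simp only [add_sub_cancel_left, sub_self] at hF
  linear_combination hF

lemma em_tendsto_cpow (w : ℂ) (hw : 0 < w.re) (n : ℕ) :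
    Filter.Tendsto (fun N : ℕ => ((n : ℂ) + (N : ℂ) + 2) ^ (-w)) Filter.atTop (nhds 0) := by
  rw [tendsto_zero_iff_norm_tendsto_zero]
  have h := (tendsto_rpow_neg_atTop hw).comp
    (tendsto_natCast_atTop_atTop (R := ℝ) |>.comp (Filter.tendsto_add_atTop_nat (n + 2)))
  refine h.congr ?_
  intro N
  have e : (n : ℂ) + (N : ℂ) + 2 = (((N + (n + 2) : ℕ) : ℝ) : ℂ) := by push_cast; ring
  rw [e, Complex.norm_cpow_eq_rpow_re_of_pos (by positivity)]
  simp

lemma em_summable (z : ℂ) (hz : 1 < z.re) (n : ℕ) :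
    Summable (fun m : ℕ => ((n : ℂ) + (m : ℂ) + 2) ^ (-z)) := by
  have h := (summable_nat_add_iff (n + 2)).mpr (Complex.summable_one_div_nat_cpow.mpr hz)
  refine h.congr ?_
  intro m
  rw [Complex.cpow_neg, one_div]
  push_cast
  congr 2
  ring

lemma em_J (z : ℂ) (hz : 1 < z.re) (n m : ℕ) :
    Filter.Tendsto (fun N : ℕ => ∑ i ∈ Finset.range N,
      ∫ x in ((n + 1 + i : ℕ) : ℝ)..(((n + 1 + i : ℕ) : ℝ) + 1), emG z m x) Filter.atTop
      (nhds (∫ x in Set.Ioi ((n : ℝ) + 1), emG z m x)) := by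
  have hint := em_integrable z hz n m
  have h := MeasureTheory.intervalIntegral_tendsto_integral_Ioi ((n : ℝ) + 1) hint
    (tendsto_natCast_atTop_atTop (R := ℝ) |>.comp (Filter.tendsto_add_atTop_nat (n + 1)))
  refine h.congr ?_
  intro N
  have hii : ∀ a b : ℕ, IntervalIntegrable (emG z m) MeasureTheory.volume
      ((n + 1 + a : ℕ) : ℝ) ((n + 1 + b : ℕ) : ℝ) := by
    intro a b
    rw [intervalIntegrable_iff]
    apply hint.mono_set
    intro x hx
    have hx := hx.1
    rw [inf_lt_iff] at hx
    push_cast at hx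
    have ha : (0 : ℝ) ≤ a := by positivity
    have hb : (0 : ℝ) ≤ b := by positivity
    simp only [Set.mem_Ioi]
    rcases hx with hx | hx <;> linarith
  have hs := intervalIntegral.sum_integral_adjacent_intervals (f := emG z m)
    (μ := MeasureTheory.volume) (a := fun i : ℕ => ((n + 1 + i : ℕ) : ℝ)) (n := N)
    (fun i _ => hii i (i + 1))
  simp only [Function.comp]
  have e0 : ((n + 1 + 0 : ℕ) : ℝ) = (n : ℝ) + 1 := by push_cast; ring
  have e1 : N + (n + 1) = n + 1 + N := by ring
  rw [e0] at hs
  rw [e1, ← hs]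
  apply Finset.sum_congr rfl
  intro i _
  congr 1
  push_cast
  ring

lemma em_recur (z : ℂ) (hz : 1 < z.re) (n m : ℕ) :
    ((m : ℂ) + 1) * ∫ x in Set.Ioi ((n : ℝ) + 1), emG z m x =
      (if m = 0 then (∑' i : ℕ, ((n : ℂ) + (i : ℂ) + 2) ^ (-z)) - ((n : ℂ) + 2) ^ (-z) else 0)
      - ((bernoulli (m + 1) : ℚ) : ℂ) * ((n : ℂ) + 2) ^ (-(z + m))
      + (z + m) * ∫ x in Set.Ioi ((n : ℝ) + 1), emG z (m + 1) x := by
  set f : ℕ → ℂ := fun i => ((n : ℂ) + (i : ℂ) + 2) ^ (-(z + m)) with hf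
  have hf0 : ((n : ℂ) + 2) ^ (-(z + m)) = f 0 := by simp [hf]
  have hlim : Filter.Tendsto f Filter.atTop (nhds 0) := by
    apply em_tendsto_cpow
    have : (0 : ℝ) ≤ m := by positivity
    simp
    linarith
  have key : ∀ N : ℕ, ((m : ℂ) + 1) * ∑ i ∈ Finset.range N,
      ∫ x in ((n + 1 + i : ℕ) : ℝ)..(((n + 1 + i : ℕ) : ℝ) + 1), emG z m x =
      (if m = 0 then ∑ i ∈ Finset.range N, f (i + 1) else 0)
      + ((bernoulli (m + 1) : ℚ) : ℂ) * (f N - f 0)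
      + (z + m) * ∑ i ∈ Finset.range N,
      ∫ x in ((n + 1 + i : ℕ) : ℝ)..(((n + 1 + i : ℕ) : ℝ) + 1), emG z (m + 1) x := by
    intro N
    induction N with
    | zero => simp
    | succ N ih =>
      rw [Finset.sum_range_succ, mul_add, ih, em_step z hz, Finset.sum_range_succ,
        Finset.sum_range_succ, bernoulliFun_eval_one, bernoulliFun_eval_zero]
      have e1 : (((n + 1 + N : ℕ) : ℂ) + 2) ^ (-(z + m)) = f (N + 1) := by
        simp only [hf]; congr 1; push_cast; ring
      have e2 : (((n + 1 + N : ℕ) : ℂ) + 1) ^ (-(z + m)) = f N := by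
        simp only [hf]; congr 1; push_cast; ring
      rw [e1, e2]
      by_cases hm : m = 0
      · simp [hm]; ring
      · simp [hm]; ring
  have L := (em_J z hz n m).const_mul ((m : ℂ) + 1)
  have R2 := ((hlim.sub_const (f 0)).const_mul ((bernoulli (m + 1) : ℚ) : ℂ))
  have R3 := (em_J z hz n (m + 1)).const_mul (z + m)
  have R1 : Filter.Tendsto (fun N : ℕ => if m = 0 then ∑ i ∈ Finset.range N, f (i + 1) else 0)
      Filter.atTop (nhds (if m = 0 then
        (∑' i : ℕ, ((n : ℂ) + (i : ℂ) + 2) ^ (-z)) - ((n : ℂ) + 2) ^ (-z) else 0)) := by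
    by_cases hm : m = 0
    · subst hm
      simp only [if_true]
      have hsum : Summable f := by simpa [hf] using em_summable z hz n
      have h1 := ((summable_nat_add_iff 1).mpr hsum).hasSum.tendsto_sum_nat
      have h2 := hsum.tsum_eq_zero_add
      have h3 : (∑' i : ℕ, ((n : ℂ) + (i : ℂ) + 2) ^ (-z)) - ((n : ℂ) + 2) ^ (-z) =
          ∑' i, f (i + 1) := by
        have : (∑' i : ℕ, ((n : ℂ) + (i : ℂ) + 2) ^ (-z)) = ∑' i, f i := by simp [hf]
        rw [this, h2, ← hf0]
        simp
      rw [h3]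
      exact h1
    · simp [hm]
  have := tendsto_nhds_unique L (((R1.add R2).add R3).congr fun N => (key N).symm)
  rw [this, hf0]
  ring

lemma em_J0 (z : ℂ) (hz : 1 < z.re) (n : ℕ) :
    ∫ x in Set.Ioi ((n : ℝ) + 1), emG z 0 x = ((n : ℂ) + 2) ^ (1 - z) / (z - 1) := by
  have hz1 : z - 1 ≠ 0 := by
    intro h
    have := congrArg Complex.re h
    simp at this
    linarith
  have hn : (0 : ℝ) ≤ n := by positivity
  have hd : ∀ x ∈ Set.Ici ((n : ℝ) + 1),
      HasDerivAt (fun y : ℝ => (-(z - 1))⁻¹ * ((1 : ℂ) + (y : ℂ)) ^ (-(z - 1)))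
        (emG z 0 x) x := by
    intro x hx
    have hx' : 0 < 1 + x := by
      have := Set.mem_Ici.mp hx
      linarith
    refine ((em_hasDerivAt_pow (z - 1) hz1 x hx').const_mul _).congr_deriv ?_
    rw [← mul_assoc, inv_mul_cancel₀ (neg_ne_zero.mpr hz1)]
    simp [emG, Complex.cpow_neg]
  have ht : Filter.Tendsto (fun y : ℝ => (-(z - 1))⁻¹ * ((1 : ℂ) + (y : ℂ)) ^ (-(z - 1)))
      Filter.atTop (nhds ((-(z - 1))⁻¹ * 0)) := by
    apply Filter.Tendsto.const_mul
    rw [tendsto_zero_iff_norm_tendsto_zero]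
    have h := (tendsto_rpow_neg_atTop (y := (z - 1).re) (by simpa using hz)).comp
      (Filter.tendsto_atTop_add_const_left Filter.atTop (1 : ℝ) Filter.tendsto_id)
    refine h.congr' ?_
    filter_upwards [Filter.eventually_gt_atTop 0] with x hx
    have e : (1 : ℂ) + (x : ℂ) = ((1 + x : ℝ) : ℂ) := by push_cast; rfl
    rw [e, Complex.norm_cpow_eq_rpow_re_of_pos (by linarith)]
    simp
  rw [MeasureTheory.integral_Ioi_of_hasDerivAt_of_tendsto' hd (em_integrable z hz n 0) ht]
  have e : (1 : ℂ) + (((n : ℝ) + 1 : ℝ) : ℂ) = (n : ℂ) + 2 := by push_cast; ring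
  rw [e, neg_sub, show (1 : ℂ) - z = -(z - 1) by ring, inv_neg]
  field_simp
  ring

lemma em_main (z : ℂ) (hz : 1 < z.re) (n k : ℕ) :
    ∑' m : ℕ, ((n : ℂ) + (m : ℂ) + 2) ^ (-z) =
      ((n : ℂ) + 2) ^ (1 - z) / (z - 1) + (1 / 2) * ((n : ℂ) + 2) ^ (-z) +
        (∑ j ∈ Finset.Icc 1 (k + 1),
          ((ascPochhammer ℂ (2 * j - 1)).eval z * ((bernoulli (2 * j) : ℚ) : ℂ) /
              (Nat.factorial (2 * j) : ℂ)) *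
            ((n : ℂ) + 2) ^ (-z - 2 * (j : ℂ) + 1)) +
        (-((ascPochhammer ℂ (2 * (k + 1))).eval z / (Nat.factorial (2 * (k + 1)) : ℂ)) *
          ∫ x in Set.Ioi ((n : ℝ) + 1), emG z (2 * (k + 1)) x) := by
  induction k with
  | zero =>
    have h0 := em_recur z hz n 0
    have h1 := em_recur z hz n 1
    rw [em_J0 z hz] at h0
    have e : -z - 2 + 1 = -(z + 1) := by ring
    simp [ascPochhammer_succ_right, e, bernoulli_two] at h0 h1 ⊢
    linear_combination -h0 - z / 2 * h1
  | succ k ih =>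
    rw [Finset.sum_Icc_succ_top (by omega), ih]
    have h0 := em_recur z hz n (2 * (k + 1))
    have h1 := em_recur z hz n (2 * (k + 1) + 1)
    have hb : bernoulli (2 * (k + 1) + 1) = 0 :=
      bernoulli_eq_zero_of_odd ⟨k + 1, rfl⟩ (by omega)
    rw [hb, if_neg (by omega)] at h0
    rw [if_neg (by omega)] at h1
    have i1 : 2 * (k + 1 + 1) = 2 * (k + 1) + 1 + 1 := by ring
    have i2 : 2 * (k + 1) + 1 + 1 - 1 = 2 * (k + 1) + 1 := by omega
    have e : -z - 2 * ((k + 1 + 1 : ℕ) : ℂ) + 1 = -(z + (2 * (k + 1) + 1 : ℕ)) := by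
      push_cast; ring
    rw [e, i1, i2]
    generalize 2 * (k + 1) = q at *
    have hF : ((q)! : ℂ) ≠ 0 := by exact_mod_cast Nat.factorial_ne_zero q
    have hA : (q : ℂ) + 1 ≠ 0 := by exact_mod_cast Nat.succ_ne_zero q
    have hB : (q : ℂ) + 1 + 1 ≠ 0 := by exact_mod_cast Nat.succ_ne_zero (q + 1)
    have c1 : ((q + 1 : ℕ) : ℂ) = (q : ℂ) + 1 := by push_cast; rfl
    have c2 : ((q + 1 + 1)! : ℂ) = ((q : ℂ) + 1 + 1) * (((q : ℂ) + 1) * (q)!) := by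
      rw [Nat.factorial_succ, Nat.factorial_succ]
      push_cast
      rfl
    rw [ascPochhammer_succ_eval (q + 1) z, ascPochhammer_succ_eval q z, c2, c1]
    rw [c1] at h1
    have g0 : (∫ x in Set.Ioi ((n : ℝ) + 1), emG z q x) =
        (z + q) * (∫ x in Set.Ioi ((n : ℝ) + 1), emG z (q + 1) x) / (q + 1) := by
      rw [eq_div_iff hA]
      simp only [Rat.cast_zero, zero_mul, sub_zero, zero_add] at h0
      linear_combination h0
    have g1 : (∫ x in Set.Ioi ((n : ℝ) + 1), emG z (q + 1) x) =
        (-((bernoulli (q + 1 + 1) : ℚ) : ℂ) * ((n : ℂ) + 2) ^ (-(z + ((q : ℂ) + 1)))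
        + (z + (q + 1)) * (∫ x in Set.Ioi ((n : ℝ) + 1), emG z (q + 1 + 1) x)) / (q + 1 + 1) := by
      rw [eq_div_iff hB]
      linear_combination h1
    rw [g0, g1]
    have alg : ∀ U V T E b P J M F : ℂ, F ≠ 0 → M + 1 ≠ 0 → M + 1 + 1 ≠ 0 →
        U + V + T + -(E / F) * ((z + M) * ((-b * P + (z + (M + 1)) * J) / (M + 1 + 1)) / (M + 1)) =
        U + V + (T + E * (z + M) * b / ((M + 1 + 1) * ((M + 1) * F)) * P) +
          -(E * (z + M) * (z + (M + 1)) / ((M + 1 + 1) * ((M + 1) * F))) * J := by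
      intro U V T E b P J M F hF hA hB
      field_simp
      ring
    exact alg _ _ _ _ _ _ _ _ _ hF hA hB

/-- Euler–Maclaurin expansion of the truncation error of the
Dirichlet series for the Riemann zeta function. For `Re z > 1`, `n ≥ 0`, `k ≥ 1`:
`Σ_{ν=n+1}^∞ (ν+1)^{-z} = (n+2)^{1-z}/(z-1) + (1/2)(n+2)^{-z}
  + Σ_{j=1}^k ((z)_{2j-1} B_{2j}/(2j)!)(n+2)^{-z-2j+1} + R_k(n,z)`,
with `R_k(n,z) = -((z)_{2k}/(2k)!)·∫_{n+1}^∞ B_{2k}(x-⌊x⌋)/(1+x)^{z+2k} dx`;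
the series on the left (indexed by `ν = n+1+m`, `m ∈ ℕ`) and the integral on the
right are both (absolutely) convergent. Here `(z)_m` is the Pochhammer symbol
`(ascPochhammer ℂ m).eval z`, `B_m(x)` the Bernoulli polynomial, `B_m` the
Bernoulli number. -/
theorem euler_maclaurin_zeta_truncation
    (z : ℂ) (hz : 1 < z.re) (n : ℕ) (k : ℕ) (hk : 1 ≤ k) :
    Summable (fun m : ℕ => ((n : ℂ) + (m : ℂ) + 2) ^ (-z)) ∧
    MeasureTheory.IntegrableOn
      (fun x : ℝ =>
        ((Polynomial.eval (x - (⌊x⌋ : ℝ))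
            ((Polynomial.bernoulli (2 * k)).map (algebraMap ℚ ℝ)) : ℝ) : ℂ) /
          ((1 : ℂ) + (x : ℂ)) ^ (z + 2 * (k : ℂ)))
      (Set.Ioi ((n : ℝ) + 1)) ∧
    ∑' m : ℕ, ((n : ℂ) + (m : ℂ) + 2) ^ (-z) =
      ((n : ℂ) + 2) ^ (1 - z) / (z - 1) + (1 / 2) * ((n : ℂ) + 2) ^ (-z) +
        (∑ j ∈ Finset.Icc 1 k,
          ((ascPochhammer ℂ (2 * j - 1)).eval z * ((bernoulli (2 * j) : ℚ) : ℂ) /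
              (Nat.factorial (2 * j) : ℂ)) *
            ((n : ℂ) + 2) ^ (-z - 2 * (j : ℂ) + 1)) +
        (-((ascPochhammer ℂ (2 * k)).eval z / (Nat.factorial (2 * k) : ℂ)) *
          ∫ x in Set.Ioi ((n : ℝ) + 1),
            ((Polynomial.eval (x - (⌊x⌋ : ℝ))
                ((Polynomial.bernoulli (2 * k)).map (algebraMap ℚ ℝ)) : ℝ) : ℂ) /
              ((1 : ℂ) + (x : ℂ)) ^ (z + 2 * (k : ℂ))) := by

  obtain ⟨k, rfl⟩ : ∃ l, k = l + 1 := ⟨k - 1, by omega⟩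
  have e : (fun x : ℝ =>
        ((Polynomial.eval (x - (⌊x⌋ : ℝ))
            ((Polynomial.bernoulli (2 * (k + 1))).map (algebraMap ℚ ℝ)) : ℝ) : ℂ) /
          ((1 : ℂ) + (x : ℂ)) ^ (z + 2 * ((k + 1 : ℕ) : ℂ))) = emG z (2 * (k + 1)) := by
    funext x
    simp only [emG, bernoulliFun]
    push_cast
    rfl
  refine ⟨em_summable z hz n, ?_, ?_⟩
  · rw [e]
    exact em_integrable z hz n _
  · rw [e]
    exact em_main z hz n k
end
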